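/- arXiv:1710.02179 — 2 statements merged into one kernel-verified Lean document; each statement's English description precedes it below -/
import Mathlib

section
/- Let Γ be a finitely generated group admitting a strictly decreasing chain Γ = Γ₀ ⊋ Γ₁ ⊋ Γ₂ ⊋ ⋯ of finite-index normal subgroups with each Γ_k isomorphic to Γ. Then for every k ≥ 1 the finite quotient group Γ/Γ_k is nilpotent. -/
set_option autoImplicit false

open Subgroup

namespace NormalSelfEmbedding

variable {G : Type*} [Group G]

theorem commutator_le_iff_le_comap_centralizer {A B X : Subgroup G} [X.Normal] :
    ⁅A, B⁆ ≤ X ↔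
      A ≤ (centralizer (B.map (QuotientGroup.mk' X) : Set (G ⧸ X))).comap
        (QuotientGroup.mk' X) := by
  rw [← map_le_iff_le_comap, ← commutator_eq_bot_iff_le_centralizer, ← map_commutator,
    Subgroup.map_eq_bot_iff, QuotientGroup.ker_mk']

theorem iSup_commutator_le {ι : Sort*} {A : ι → Subgroup G} {B X : Subgroup G} [X.Normal]
    (h : ∀ i, ⁅A i, B⁆ ≤ X) : ⁅⨆ i, A i, B⁆ ≤ X :=
  commutator_le_iff_le_comap_centralizer.2 <|
    iSup_le fun i => commutator_le_iff_le_comap_centralizer.1 (h i)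

theorem commutator_sup_le {A B C X : Subgroup G} [X.Normal]
    (hB : ⁅A, B⁆ ≤ X) (hC : ⁅A, C⁆ ≤ X) : ⁅A, B ⊔ C⁆ ≤ X := by
  rw [commutator_comm] at hB hC ⊢
  rw [commutator_le_iff_le_comap_centralizer] at *
  exact sup_le hB hC

/-- The lower central series of `S`, shifted by one so as to start with the whole group. -/
def shiftedSeries (S : Subgroup G) : ℕ → Subgroup G
  | 0 => ⊤
  | i + 1 => S.lowerCentralSeries i

instance shiftedSeries_normal (S : Subgroup G) [S.Normal] (i : ℕ) :
    (shiftedSeries S i).Normal := by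
  cases i <;> (simp only [shiftedSeries]; infer_instance)

theorem commutator_shiftedSeries_le (S : Subgroup G) [S.Normal] (i : ℕ) :
    ⁅shiftedSeries S i, S⁆ ≤ shiftedSeries S (i + 1) := by
  cases i with
  | zero => simpa [shiftedSeries] using commutator_le_right ⊤ S
  | succ i => exact le_rfl

theorem lowerCentralSeries_sup_le (S T : Subgroup G) [S.Normal] [T.Normal] (n : ℕ) :
    (S ⊔ T).lowerCentralSeries n ≤
      ⨆ p : {p : ℕ × ℕ // p.1 + p.2 = n + 1},
        shiftedSeries S p.1.1 ⊓ shiftedSeries T p.1.2 := by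
  induction n with
  | zero =>
    rw [Subgroup.lowerCentralSeries_zero]
    refine sup_le (le_iSup_of_le ⟨(1, 0), rfl⟩ ?_) (le_iSup_of_le ⟨(0, 1), rfl⟩ ?_) <;>
      simp [shiftedSeries]
  | succ n ih =>
    rw [Subgroup.lowerCentralSeries_succ]
    refine (commutator_mono ih le_rfl).trans (iSup_commutator_le ?_)
    rintro ⟨⟨i, j⟩, hij⟩
    dsimp only at hij ⊢
    refine commutator_sup_le ?_ ?_
    · refine le_iSup_of_le ⟨(i + 1, j), by dsimp only; omega⟩ (le_inf ?_ ?_)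
      · exact (commutator_mono inf_le_left le_rfl).trans (commutator_shiftedSeries_le S i)
      · exact (commutator_mono inf_le_right le_rfl).trans (commutator_le_left _ _)
    · refine le_iSup_of_le ⟨(i, j + 1), by dsimp only; omega⟩ (le_inf ?_ ?_)
      · exact (commutator_mono inf_le_left le_rfl).trans (commutator_le_left _ _)
      · exact (commutator_mono inf_le_right le_rfl).trans (commutator_shiftedSeries_le T j)

/-- `S` is nilpotent modulo `R`: some term of its lower central series lies in `R`. -/
def NilpotentMod (R S : Subgroup G) : Prop := ∃ c, S.lowerCentralSeries c ≤ R

theorem NilpotentMod.mono {R R' S S' : Subgroup G} (h : NilpotentMod R S) (hR : R ≤ R')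
    (hS : S' ≤ S) : NilpotentMod R' S' :=
  h.imp fun c hc => ((lowerCentralSeries_mono c) hS).trans (hc.trans hR)

theorem nilpotentMod_self (R : Subgroup G) : NilpotentMod R R := ⟨0, le_rfl⟩

/-- Fitting's theorem, relative to a subgroup. -/
theorem NilpotentMod.sup {R S T : Subgroup G} [S.Normal] [T.Normal]
    (hS : NilpotentMod R S) (hT : NilpotentMod R T) : NilpotentMod R (S ⊔ T) := by
  obtain ⟨c, hc⟩ := hS
  obtain ⟨d, hd⟩ := hT
  refine ⟨c + d, (lowerCentralSeries_sup_le S T _).trans (iSup_le ?_)⟩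
  rintro ⟨⟨i, j⟩, hij⟩
  dsimp only at hij ⊢
  rcases Nat.lt_or_ge c i with h | h
  · obtain ⟨i, rfl⟩ := Nat.exists_eq_add_of_lt h
    exact inf_le_left.trans ((S.lowerCentralSeries_antitone (by omega)).trans hc)
  · obtain ⟨j, rfl⟩ : ∃ j', j = d + j' + 1 := ⟨j - d - 1, by omega⟩
    exact inf_le_right.trans ((T.lowerCentralSeries_antitone (by omega)).trans hd)

/-- The Fitting subgroup relative to `R`: the largest normal subgroup nilpotent modulo `R`. -/
theorem exists_fitting (R : Subgroup G) [R.Normal] [R.FiniteIndex] :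
    ∃ A : Subgroup G, A.Normal ∧ NilpotentMod R A ∧ R ≤ A ∧
      ∀ T : Subgroup G, T.Normal → NilpotentMod R T → T ≤ A := by
  obtain ⟨A, ⟨hA, hRA, hnil⟩, hmin⟩ := exists_minimalFor_of_wellFoundedLT
    (fun A : Subgroup G => A.Normal ∧ R ≤ A ∧ NilpotentMod R A) (fun A => A.index)
    ⟨R, inferInstance, le_rfl, nilpotentMod_self R⟩
  refine ⟨A, hA, hnil, hRA, fun T hT hTnil => ?_⟩
  have := finiteIndex_of_le hRA
  have h := hmin (j := A ⊔ T) ⟨inferInstance, hRA.trans le_sup_left, hnil.sup hTnil⟩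
    (index_antitone le_sup_left)
  by_contra hcon
  exact absurd (index_strictAnti (left_lt_sup.2 hcon)) h.not_gt

/-- The intersection of the kernels of all permutation representations of degree at most `n`. -/
def permResidual (G : Type*) [Group G] (n : ℕ) : Subgroup G :=
  ⨅ i : Fin (n + 1), ⨅ f : G →* Equiv.Perm (Fin i), f.ker

theorem mem_permResidual {n : ℕ} {x : G} :
    x ∈ permResidual G n ↔ ∀ i ≤ n, ∀ f : G →* Equiv.Perm (Fin i), f x = 1 := by
  simp only [permResidual, mem_iInf, MonoidHom.mem_ker]
  exact ⟨fun h i hi => h ⟨i, Nat.lt_succ_of_le hi⟩, fun h i => h i (Nat.le_of_lt_succ i.2)⟩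

theorem permResidual_antitone : Antitone (permResidual G) := fun _ _ hmn _ hx =>
  mem_permResidual.2 fun i hi => mem_permResidual.1 hx i (hi.trans hmn)

theorem map_permResidual_le {K : Type*} [Group K] (f : G →* K) (n : ℕ) :
    (permResidual G n).map f ≤ permResidual K n := by
  rintro _ ⟨x, hx, rfl⟩
  exact mem_permResidual.2 fun i hi g => mem_permResidual.1 hx i hi (g.comp f)

instance permResidual_normal (n : ℕ) : (permResidual G n).Normal :=
  normal_iInf_normal fun _ => normal_iInf_normal fun _ => inferInstance

theorem finite_monoidHom [Group.FG G] (P : Type*) [Group P] [Finite P] : Finite (G →* P) := by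
  obtain ⟨S, hS, hfin⟩ := Group.fg_iff.1 ‹Group.FG G›
  have := hfin.to_subtype
  refine Finite.of_injective (fun (f : G →* P) (s : S) => f s) fun f g h => ?_
  exact MonoidHom.eq_of_eqOn_dense hS fun s hs => congrFun h ⟨s, hs⟩

instance permResidual_finiteIndex [Group.FG G] (n : ℕ) : (permResidual G n).FiniteIndex := by
  refine finiteIndex_iInf fun i => ?_
  have := finite_monoidHom (G := G) (Equiv.Perm (Fin i))
  exact finiteIndex_iInf fun f => inferInstance

theorem apply_eq_one_of_mem_permResidual {X : Type*} [Finite X] {x : G}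
    (hx : x ∈ permResidual G (Nat.card X)) (f : G →* Equiv.Perm X) : f x = 1 := by
  have h := mem_permResidual.1 hx _ le_rfl
    ((Finite.equivFin X).permCongrHom.toMonoidHom.comp f)
  exact (Finite.equivFin X).permCongrHom.injective (h.trans (map_one _).symm)

theorem permResidual_index_le (R : Subgroup G) [R.Normal] [R.FiniteIndex] :
    permResidual G R.index ≤ R := by
  intro x hx
  have h := apply_eq_one_of_mem_permResidual hx (MulAction.toPermHom G (G ⧸ R))
  have h1 : x • ((1 : G) : G ⧸ R) = ((1 : G) : G ⧸ R) := by
    simpa using congrArg (fun σ : Equiv.Perm (G ⧸ R) => σ ((1 : G) : G ⧸ R)) h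
  rw [MulAction.Quotient.smul_coe, smul_eq_mul, mul_one] at h1
  simpa using h1

/-- A bounded permutation residual centralizes every section of bounded order. -/
theorem commutator_permResidual_le {R' R : Subgroup G} [R'.Normal] [R.Normal]
    (hne : R'.relIndex R ≠ 0) :
    ⁅R, permResidual G (R'.relIndex R)⁆ ≤ R' := by
  have hcard : Nat.card (R.map (QuotientGroup.mk' R')) = R'.relIndex R := by
    rw [← relIndex_ker, QuotientGroup.ker_mk']
  have hnorm : (R.map (QuotientGroup.mk' R')).Normal :=
    Normal.map inferInstance _ (QuotientGroup.mk'_surjective R')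
  have : Finite (R.map (QuotientGroup.mk' R')) := Nat.finite_of_card_ne_zero (hcard ▸ hne)
  rw [commutator_comm, commutator_le]
  intro c hc x hx
  rw [← hcard] at hc
  have h := apply_eq_one_of_mem_permResidual hc
    ((MulAut.toPerm _).comp ((MulAut.conjNormal
      (H := R.map (QuotientGroup.mk' R'))).comp (QuotientGroup.mk' R')))
  have h1 := congrArg (fun σ : Equiv.Perm (R.map (QuotientGroup.mk' R')) =>
    ((σ ⟨_, mem_map_of_mem _ hx⟩ : R.map (QuotientGroup.mk' R')) : G ⧸ R')) h
  have h2 : (QuotientGroup.mk' R' c) * (QuotientGroup.mk' R' x) * (QuotientGroup.mk' R' c)⁻¹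
      = QuotientGroup.mk' R' x := h1
  rw [← QuotientGroup.ker_mk' R', MonoidHom.mem_ker, map_commutatorElement,
    commutatorElement_def, h2, mul_inv_cancel]

/-- The image of a permutation residual under an injective endomorphism with normal range is
normal. -/
theorem map_permResidual_normal {ψ : G →* G} (hψ : Function.Injective ψ) [ψ.range.Normal]
    (n : ℕ) : ((permResidual G n).map ψ).Normal := by
  refine ⟨?_⟩
  rintro _ ⟨x, hx, rfl⟩ g
  let e := MonoidHom.ofInjective hψ
  let θ : G →* G := e.symm.toMonoidHom.comp ((MulAut.conjNormal g).toMonoidHom.comp e.toMonoidHom)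
  refine ⟨θ x, map_permResidual_le θ n (mem_map_of_mem θ hx), ?_⟩
  have h : e (θ x) = MulAut.conjNormal g (e x) := e.apply_symm_apply _
  have h' := congrArg Subtype.val h
  rwa [MulAut.conjNormal_apply] at h'

theorem nilpotentMod_range [Group.FG G] {ψ : G →* G} (hψ : Function.Injective ψ)
    [ψ.range.Normal] [ψ.range.FiniteIndex] : NilpotentMod ψ.range (⊤ : Subgroup G) := by
  set R : ℕ → Subgroup G := permResidual G
  set R' : ℕ → Subgroup G := fun n => (R n).map ψ
  have hR'norm (n : ℕ) : (R' n).Normal := map_permResidual_normal hψ n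
  have hR'R (n : ℕ) : R' n ≤ R n := map_permResidual_le ψ n
  have hindex (n : ℕ) : (R' n).index = (R n).index * ψ.range.index :=
    index_map_of_injective _ hψ
  have hR'fin (n : ℕ) : (R' n).FiniteIndex :=
    ⟨hindex n ▸ mul_ne_zero FiniteIndex.index_ne_zero FiniteIndex.index_ne_zero⟩
  have hrel (n : ℕ) : (R' n).relIndex (R n) = ψ.range.index := by
    have h := relIndex_mul_index (hR'R n)
    rw [hindex, mul_comm] at h
    exact Nat.eq_of_mul_eq_mul_left (Nat.pos_of_ne_zero FiniteIndex.index_ne_zero) h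
  set C : Subgroup G := R ψ.range.index
  have hC (n : ℕ) : ⁅R n, C⁆ ≤ R' n := by
    have h := commutator_permResidual_le (R' := R' n) (R := R n)
      (by rw [hrel]; exact FiniteIndex.index_ne_zero)
    rwa [hrel] at h
  choose A hAnorm hAnil hRA hAmax using fun n => exists_fitting (R n)
  choose B hBnorm hBnil hRB hBmax using fun n => exists_fitting (R' n)
  have hAfin (n : ℕ) : (A n).FiniteIndex := finiteIndex_of_le (hRA n)
  have hBfin (n : ℕ) : (B n).FiniteIndex := finiteIndex_of_le (hRB n)
  have hCA (n : ℕ) : (A n ⊔ C).FiniteIndex := finiteIndex_of_le (le_sup_left (a := A n))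
  obtain ⟨n, hn⟩ : ∃ n, ∀ m, (A m ⊔ C).index ≤ (A n ⊔ C).index := by
    have hbdd : BddAbove (Set.range fun n => (A n ⊔ C).index) :=
      ⟨C.index, by rintro _ ⟨n, rfl⟩; exact index_antitone le_sup_right⟩
    obtain ⟨n, hn⟩ := Nat.sSup_mem (Set.range_nonempty _) hbdd
    exact ⟨n, fun m => (le_csSup hbdd ⟨m, rfl⟩).trans_eq hn.symm⟩
  obtain ⟨m, hmn, hmR⟩ : ∃ m, n ≤ m ∧ R m ≤ R' n :=
    ⟨max n (R' n).index, le_max_left _ _,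
      (permResidual_antitone (le_max_right _ _)).trans (permResidual_index_le (R' n))⟩
  have hBA : B n ≤ A n := hAmax n _ (hBnorm n) ((hBnil n).mono (hR'R n) le_rfl)
  have hAmA : A m ≤ A n :=
    hAmax n _ (hAnorm m) ((hAnil m).mono (permResidual_antitone hmn) le_rfl)
  have hAmB : A m ≤ B n := hBmax n _ (hAnorm m) ((hAnil m).mono hmR le_rfl)
  have hsup : A m ⊔ C = A n ⊔ C := by
    refine (sup_le_sup_right hAmA C).eq_of_not_lt fun hlt => ?_
    exact absurd (index_strictAnti hlt) (hn m).not_gt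
  have hinf : A n ⊓ C ≤ B n := by
    refine hBmax n _ inferInstance ?_
    obtain ⟨c, hc⟩ := hAnil n
    refine ⟨c + 1, ?_⟩
    rw [Subgroup.lowerCentralSeries_succ]
    exact (commutator_mono ((lowerCentralSeries_mono c inf_le_left).trans hc)
      inf_le_right).trans (hC n)
  have hAB : A n = B n := by
    refine le_antisymm ?_ hBA
    intro x hx
    have hx' : x ∈ B n ⊔ C :=
      sup_le_sup_right hAmB C (hsup.ge (le_sup_left (a := A n) hx))
    obtain ⟨b, hb, c, hc, rfl⟩ := mem_sup_of_normal_left.1 hx'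
    exact mul_mem hb (hinf ⟨(mul_mem_cancel_left (hBA hb)).1 hx, hc⟩)
  have hcomap : (B n).comap ψ ≤ A n := by
    refine hAmax n _ inferInstance ?_
    obtain ⟨c, hc⟩ := hBnil n
    refine ⟨c, ?_⟩
    rw [← map_le_map_iff_of_injective hψ, map_lowerCentralSeries]
    exact (lowerCentralSeries_mono c (map_comap_le ψ (B n))).trans hc
  have htop : B n ⊔ ψ.range = ⊤ := by
    have h1 : (B n).index ≤ (B n).relIndex (B n ⊔ ψ.range) := by
      rw [relIndex_sup_left, ← index_comap]
      have : ((B n).comap ψ).FiniteIndex :=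
        ⟨index_comap (B n) ψ ▸ (isFiniteRelIndex_of_finiteIndex (H := B n)).relIndex_ne_zero⟩
      exact (congrArg index hAB).ge.trans (index_antitone hcomap)
    rw [← relIndex_mul_index (le_sup_left : B n ≤ B n ⊔ ψ.range)] at h1
    have hpos : 0 < (B n).relIndex (B n ⊔ ψ.range) :=
      Nat.pos_of_ne_zero fun h0 => (hBfin n).index_ne_zero <| by
        rw [← relIndex_mul_index (le_sup_left : B n ≤ B n ⊔ ψ.range), h0, zero_mul]
    have hne : (B n ⊔ ψ.range).index ≠ 0 := by
      have := finiteIndex_of_le (le_sup_left : B n ≤ B n ⊔ ψ.range)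
      exact FiniteIndex.index_ne_zero
    rw [← index_eq_one]
    have := Nat.le_of_mul_le_mul_left (h1.trans_eq (mul_one _).symm) hpos
    omega
  rw [← htop]
  exact ((hBnil n).mono (MonoidHom.range_eq_map ψ ▸ map_mono le_top) le_rfl).sup
    (nilpotentMod_self _)

end NormalSelfEmbedding

/-- **Proposition.** If a finitely generated group `Γ` admits a strictly decreasing chain
`Γ = Γ₀ ⊋ Γ₁ ⊋ ⋯` of finite-index normal subgroups, each isomorphic to `Γ`, then each
finite quotient `Γ ⧸ Γₖ` (`k ≥ 1`) is nilpotent. -/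
theorem quotients_nilpotent {Γ : Type*} [Group Γ] (hfg : Group.FG Γ)
    (H : ℕ → Subgroup Γ) (h0 : H 0 = ⊤)
    (hdec : ∀ k, H (k + 1) < H k)
    (hnorm : ∀ k, (H k).Normal)
    (hfin : ∀ k, (H k).FiniteIndex)
    (hiso : ∀ k, Nonempty (H k ≃* Γ)) :
    ∀ k, 1 ≤ k →
      (haveI : (H k).Normal := hnorm k
       Group.IsNilpotent (Γ ⧸ H k)) := by
  intro k _
  have := hnorm k
  have := hfin k
  obtain ⟨e⟩ := hiso k
  let ψ : Γ →* Γ := (H k).subtype.comp e.symm.toMonoidHom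
  have hψ : Function.Injective ψ := (H k).subtype_injective.comp e.symm.injective
  have hrange : ψ.range = H k := by
    rw [MonoidHom.range_comp, MonoidHom.range_eq_top.2 e.symm.surjective,
      ← MonoidHom.range_eq_map, Subgroup.range_subtype]
  have : ψ.range.Normal := hrange ▸ hnorm k
  have : ψ.range.FiniteIndex := hrange ▸ hfin k
  obtain ⟨c, hc⟩ := NormalSelfEmbedding.nilpotentMod_range hψ
  rw [hrange] at hc
  refine Subgroup.nilpotent_iff_lowerCentralSeries.2 ⟨c, ?_⟩
  rw [← Subgroup.map_top_of_surjective _ (QuotientGroup.mk'_surjective (H k)),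
    ← Subgroup.map_lowerCentralSeries, Subgroup.map_eq_bot_iff, QuotientGroup.ker_mk']
  exact hc
end

section
/- For all r, d, N ≥ 1 there exists M ≥ 1 with the following property: every solvable group G that is generated by at most r elements, whose exponent is finite and at most N (every element g satisfies gᵉ = 1 for some e ≤ N independent of g, i.e. g^{N!} = 1 for all g suffices), and whose derived series reaches the trivial subgroup in at most d steps, is finite of order at most M. In particular, up to isomorphism there are only finitely many such groups. -/
set_option autoImplicit false

universe u

open scoped commutatorElement

/-- In a commutative group whose elements have positive order at most `N`, a finite set `S`
generates a finite subgroup with at most `N ^ S.card` elements. -/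
theorem finite_closure_and_card_closure_le_pow {A : Type*} [CommGroup A] {N : ℕ}
    (hA : ∀ g : A, ∃ e : ℕ, 1 ≤ e ∧ e ≤ N ∧ g ^ e = 1) (S : Finset A) :
    Finite (Subgroup.closure (S : Set A)) ∧
      Nat.card (Subgroup.closure (S : Set A)) ≤ N ^ S.card := by
  classical
  induction S using Finset.induction_on with
  | empty =>
    rw [Finset.coe_empty, Subgroup.closure_empty]
    exact ⟨inferInstance, by simp⟩
  | insert a S ha ih =>
    obtain ⟨hfin, hcard⟩ := ih
    obtain ⟨e, he1, heN, he⟩ := hA a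
    have hfa : Finite (Subgroup.zpowers a) :=
      (isOfFinOrder_iff_pow_eq_one.2 ⟨e, he1, he⟩).finite_zpowers
    have hca : Nat.card (Subgroup.zpowers a) ≤ N := by
      rw [Nat.card_zpowers]
      exact (orderOf_le_of_pow_eq_one he1 he).trans heN
    have hsup : Subgroup.closure ((insert a S : Finset A) : Set A) =
        Subgroup.zpowers a ⊔ Subgroup.closure (S : Set A) := by
      rw [Finset.coe_insert, Set.insert_eq, Subgroup.closure_union,
        Subgroup.zpowers_eq_closure]
    rw [hsup]
    let f : Subgroup.zpowers a × Subgroup.closure (S : Set A) →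
        ↥(Subgroup.zpowers a ⊔ Subgroup.closure (S : Set A)) :=
      fun p => ⟨p.1 * p.2, Subgroup.mul_mem_sup p.1.2 p.2.2⟩
    have hf : Function.Surjective f := by
      rintro ⟨x, hx⟩
      obtain ⟨y, hy, z, hz, rfl⟩ := Subgroup.mem_sup.1 hx
      exact ⟨(⟨y, hy⟩, ⟨z, hz⟩), rfl⟩
    refine ⟨Finite.of_surjective f hf, (Nat.card_le_card_of_surjective f hf).trans ?_⟩
    rw [Nat.card_prod, Finset.card_insert_of_notMem ha, pow_succ']
    exact Nat.mul_le_mul hca hcard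

/-- **Lemma (finiteness of bounded solvable groups).** For all `r, d, N ≥ 1` there is `M ≥ 1`
such that every solvable group of derived length at most `d`, generated by at most `r` elements
and of exponent at most `N` (every element `g` satisfies `g ^ e = 1` for some `1 ≤ e ≤ N`), is
finite of order at most `M`. -/
theorem bounded_solvable_groups_finite :
    ∀ r d N : ℕ, 1 ≤ r → 1 ≤ d → 1 ≤ N →
      ∃ M : ℕ, 1 ≤ M ∧
        ∀ (G : Type u) [Group G],
          (∃ S : Finset G, S.card ≤ r ∧ Subgroup.closure (S : Set G) = ⊤) →
          (∀ g : G, ∃ e : ℕ, 1 ≤ e ∧ e ≤ N ∧ g ^ e = 1) →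
          derivedSeries G d = ⊥ →
          Finite G ∧ Nat.card G ≤ M := by
  classical
  intro r d N _ _ hN
  clear * - hN
  induction d with
  | zero =>
    refine ⟨1, le_rfl, fun G _ _ _ h => ?_⟩
    have : Subsingleton G :=
      Subgroup.subsingleton_iff.1 (subsingleton_of_bot_eq_top (h.symm.trans rfl))
    exact ⟨inferInstance, Nat.card_of_subsingleton (1 : G) |>.le⟩
  | succ n ih =>
    obtain ⟨M, hM, ih⟩ := ih
    refine ⟨N ^ (M * r) * M, Nat.mul_pos (pow_pos hN _) hM, ?_⟩
    rintro G _ ⟨S, hSr, hS⟩ hG hd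
    set A : Subgroup G := derivedSeries G n with hAdef
    have hnormal : A.Normal := derivedSeries_normal G n
    have hQ : Finite (G ⧸ A) ∧ Nat.card (G ⧸ A) ≤ M := by
      refine ih (G ⧸ A) ⟨S.image (QuotientGroup.mk' A), Finset.card_image_le.trans hSr, ?_⟩ ?_ ?_
      · rw [Finset.coe_image, ← MonoidHom.map_closure, hS]
        exact Subgroup.map_top_of_surjective _ (QuotientGroup.mk'_surjective A)
      · intro g
        obtain ⟨g, rfl⟩ := QuotientGroup.mk'_surjective A g
        obtain ⟨e, he1, heN, he⟩ := hG g
        exact ⟨e, he1, heN, by rw [← map_pow, he, map_one]⟩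
      · rw [← map_derivedSeries_eq (QuotientGroup.mk'_surjective A) n, ← hAdef,
          QuotientGroup.map_mk'_self]
    obtain ⟨hQfin, hQcard⟩ := hQ
    have hindex : A.FiniteIndex := Subgroup.finiteIndex_of_finite_quotient
    obtain ⟨T, hTcard, hT⟩ := A.exists_finset_card_le_mul hS
    have hcomm : ∀ x y : A, x * y = y * x := by
      intro x y
      have hxy : ⁅(x : G), (y : G)⁆ ∈ derivedSeries G (n + 1) :=
        Subgroup.commutator_mem_commutator x.2 y.2
      rw [hd, Subgroup.mem_bot] at hxy
      exact Subtype.ext (commutatorElement_eq_one_iff_mul_comm.1 hxy)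
    let _ : CommGroup A := { (inferInstance : Group A) with mul_comm := hcomm }
    have hA : ∀ g : A, ∃ e : ℕ, 1 ≤ e ∧ e ≤ N ∧ g ^ e = 1 := by
      intro g
      obtain ⟨e, he1, heN, he⟩ := hG g
      exact ⟨e, he1, heN, Subtype.ext he⟩
    obtain ⟨hfin, hcard⟩ := finite_closure_and_card_closure_le_pow hA T
    have hT' : Subgroup.closure (T : Set A) = ⊤ := hT
    rw [hT'] at hfin hcard
    have hAfin : Finite A := Finite.of_equiv _ Subgroup.topEquiv.toEquiv
    rw [Subgroup.card_top] at hcard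
    refine ⟨Finite.of_subgroup_quotient A, ?_⟩
    rw [← A.card_mul_index]
    refine Nat.mul_le_mul (hcard.trans (Nat.pow_le_pow_right hN ?_)) hQcard
    exact hTcard.trans (Nat.mul_le_mul hQcard hSr)
end
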